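/- arXiv:math/0412263 — 2 statements merged into one kernel-verified Lean document; each statement's English description precedes it below -/
import Mathlib

section
/- Let G be an infinite, locally finite graph, let K be a finite set of edges, and let U and U' be injective labelings of the edges that agree on all edges outside K. Then the free minimal spanning forests satisfy |(F_f(U) Δ F_f(U')) \ K| ≤ |K|, and the wired minimal spanning forests satisfy |(F_w(U) Δ F_w(U')) \ K| ≤ |K|. In particular, if U and U' differ at only a single edge e, then F_f(U) and F_f(U') differ at most at e and at one other edge, and likewise for F_w. -/
open SimpleGraph

/-- The set of edges of `G` whose endpoints cannot be joined by a path all of whose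
edges have strictly smaller label: the (free) minimal spanning forest / tree of `G`. -/
def mstEdges {V α : Type*} [LinearOrder α] (G : SimpleGraph V) (U : Sym2 V → α) :
    Set (Sym2 V) :=
  {e | e ∈ G.edgeSet ∧ ∀ a b : V, e = s(a, b) →
    ∀ p : G.Walk a b, p.IsPath → ∃ f ∈ p.edges, U e ≤ U f}

/-- A one-sided infinite simple path in `G`. -/
def IsRay {V : Type*} (G : SimpleGraph V) (r : ℕ → V) : Prop :=
  Function.Injective r ∧ ∀ n : ℕ, G.Adj (r n) (r (n + 1))

/-- The edges of a one-sided infinite path. -/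
def rayEdges {V : Type*} (r : ℕ → V) : Set (Sym2 V) :=
  Set.range fun n : ℕ => s(r n, r (n + 1))

/-- The wired minimal spanning forest of `G`: edges such that every extended path
(finite simple path, or pair of disjoint rays from the two endpoints) joining the
endpoints contains an edge of label at least as large. -/
def wmsfEdges {V : Type*} (G : SimpleGraph V) (U : Sym2 V → ℝ) : Set (Sym2 V) :=
  {e | e ∈ G.edgeSet ∧ ∀ a b : V, e = s(a, b) →
    (∀ p : G.Walk a b, p.IsPath → ∃ f ∈ p.edges, U e ≤ U f) ∧
    (∀ r₁ r₂ : ℕ → V, IsRay G r₁ → IsRay G r₂ → r₁ 0 = a → r₂ 0 = b →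
      (∀ m n : ℕ, r₁ m ≠ r₂ n) →
      ∃ f ∈ rayEdges r₁ ∪ rayEdges r₂, U e ≤ U f)}

/-- The edges of `G` joining `W` to its complement. -/
def cutEdges {V : Type*} (G : SimpleGraph V) (W : Set V) : Set (Sym2 V) :=
  {e | e ∈ G.edgeSet ∧ ∃ a b : V, e = s(a, b) ∧ a ∈ W ∧ b ∉ W}

/-- A bi-infinite simple path in `G`. -/
def IsBiRay {V : Type*} (G : SimpleGraph V) (r : ℤ → V) : Prop :=
  Function.Injective r ∧ ∀ n : ℤ, G.Adj (r n) (r (n + 1))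

/-- The edges of a bi-infinite simple path. -/
def biRayEdges {V : Type*} (r : ℤ → V) : Set (Sym2 V) :=
  Set.range fun n : ℤ => s(r n, r (n + 1))

/-- The subgraph of `G` formed by the edges of label less than `t`. -/
def levelGraph {V : Type*} (G : SimpleGraph V) (U : Sym2 V → ℝ) (t : ℝ) : SimpleGraph V :=
  SimpleGraph.fromEdgeSet {f | f ∈ G.edgeSet ∧ U f < t}

/-- The incidence vector of an edge over the field with two elements. -/
noncomputable def incVec {V : Type*} : Sym2 V → (V →₀ ZMod 2) :=
  Sym2.lift ⟨fun a b => Finsupp.single a 1 + Finsupp.single b 1, fun _ _ => add_comm _ _⟩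

/-- The span of the edges of `H`, where all vertices of `S` are identified with a root `0`. -/
noncomputable def rootedSpan {V : Type*} (H : SimpleGraph V) (S : Set V) :
    Submodule (ZMod 2) (V →₀ ZMod 2) :=
  Submodule.span (ZMod 2) (incVec '' H.edgeSet ∪ (fun x => Finsupp.single x 1) '' S)

/-- The vertices lying in an infinite connected component. -/
def infVerts {V : Type*} (H : SimpleGraph V) : Set V :=
  {a | {x | H.Reachable a x}.Infinite}

section Linear

variable {V : Type*} {G H : SimpleGraph V} {S : Set V}

@[simp] lemma incVec_mk (a b : V) :
    incVec s(a, b) = Finsupp.single a 1 + Finsupp.single b 1 := rfl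

lemma finsupp_zmod_two_add_self (v : V →₀ ZMod 2) : v + v = 0 := by
  ext x
  exact CharTwo.add_self_eq_zero (v x)

lemma incVec_mem_of_reachable {W : Submodule (ZMod 2) (V →₀ ZMod 2)}
    (hW : ∀ e ∈ H.edgeSet, incVec e ∈ W) {a b : V} (h : H.Reachable a b) :
    incVec s(a, b) ∈ W := by
  obtain ⟨p⟩ := h
  induction p with
  | nil => simp [finsupp_zmod_two_add_self]
  | @cons u v w huv p ih =>
    have h1 := W.add_mem (hW s(u, v) huv) ih
    have h2 : incVec s(u, v) + incVec s(v, w) = incVec s(u, w) := by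
      simp only [incVec_mk]
      rw [add_add_add_comm, add_comm (Finsupp.single v _), add_add_add_comm,
        finsupp_zmod_two_add_self, add_zero]
    rwa [h2] at h1

lemma incVec_mem_rootedSpan_of_edge {e : Sym2 V} (he : e ∈ H.edgeSet) :
    incVec e ∈ rootedSpan H S :=
  Submodule.subset_span (Or.inl ⟨e, he, rfl⟩)

lemma single_mem_rootedSpan {x : V} (hx : x ∈ S) :
    Finsupp.single x 1 ∈ rootedSpan H S :=
  Submodule.subset_span (Or.inr ⟨x, hx, rfl⟩)

lemma rootedSpan_mono {H' : SimpleGraph V} {S' : Set V} (hH : H ≤ H') (hS : S ⊆ S') :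
    rootedSpan H S ≤ rootedSpan H' S' :=
  Submodule.span_mono (Set.union_subset_union
    (Set.image_mono (SimpleGraph.edgeSet_mono hH)) (Set.image_mono hS))

lemma incVec_notMem_rootedSpan {a b : V} (hab : ¬ H.Reachable a b)
    (ha : ∀ x ∈ S, ¬ H.Reachable a x) : incVec s(a, b) ∉ rootedSpan H S := by
  classical
  intro hmem
  let φ : (V →₀ ZMod 2) →ₗ[ZMod 2] ZMod 2 :=
    Finsupp.linearCombination (ZMod 2) (fun x => if H.Reachable a x then (1 : ZMod 2) else 0)
  have hle : rootedSpan H S ≤ LinearMap.ker φ := by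
    refine Submodule.span_le.2 ?_
    rintro _ (⟨e, he, rfl⟩ | ⟨x, hx, rfl⟩)
    · induction e using Sym2.ind with
      | _ u v =>
        have huv : H.Reachable u v := SimpleGraph.Adj.reachable he
        have : H.Reachable a u ↔ H.Reachable a v :=
          ⟨fun h => h.trans huv, fun h => h.trans huv.symm⟩
        simp [φ, this, CharTwo.add_self_eq_zero]
    · simp [φ, ha x hx]
  have h0 : φ (incVec s(a, b)) = 0 := hle hmem
  simp [φ, hab] at h0

lemma incVec_mem_rootedSpan_iff (hS : ∀ x ∈ S, ∀ y, H.Reachable x y → y ∈ S) {a b : V} :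
    incVec s(a, b) ∈ rootedSpan H S ↔ H.Reachable a b ∨ (a ∈ S ∧ b ∈ S) := by
  constructor
  · intro h
    by_contra! hcon
    obtain ⟨hab, hS'⟩ := hcon
    by_cases ha : a ∈ S
    · rw [Sym2.eq_swap] at h
      exact incVec_notMem_rootedSpan (fun h => hab h.symm)
        (fun x hx hbx => hS' ha (hS x hx b hbx.symm)) h
    · exact incVec_notMem_rootedSpan hab (fun x hx hax => ha (hS x hx a hax.symm)) h
  · rintro (h | ⟨ha, hb⟩)
    · exact incVec_mem_of_reachable (fun e he => incVec_mem_rootedSpan_of_edge he) h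
    · exact Submodule.add_mem _ (single_mem_rootedSpan ha) (single_mem_rootedSpan hb)

lemma rootedSpan_sup_le {S' : Set V} {K : Set (Sym2 V)}
    (hS : ∀ x ∈ S', ∃ y ∈ S, (H ⊔ SimpleGraph.fromEdgeSet K).Reachable x y) :
    rootedSpan (H ⊔ SimpleGraph.fromEdgeSet K) S' ≤
      rootedSpan H S ⊔ Submodule.span (ZMod 2) (incVec '' K) := by
  have hE : ∀ e ∈ (H ⊔ SimpleGraph.fromEdgeSet K).edgeSet,
      incVec e ∈ rootedSpan H S ⊔ Submodule.span (ZMod 2) (incVec '' K) := by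
    intro e he
    rw [SimpleGraph.edgeSet_sup, SimpleGraph.edgeSet_fromEdgeSet] at he
    rcases he with he | he
    · exact Submodule.mem_sup_left (incVec_mem_rootedSpan_of_edge he)
    · exact Submodule.mem_sup_right (Submodule.subset_span ⟨e, he.1, rfl⟩)
  refine Submodule.span_le.2 ?_
  rintro _ (⟨e, he, rfl⟩ | ⟨x, hx, rfl⟩)
  · exact hE e he
  · obtain ⟨y, hy, hxy⟩ := hS x hx
    have h1 := incVec_mem_of_reachable hE hxy
    have h2 := Submodule.add_mem _ h1
      (Submodule.mem_sup_left (T := Submodule.span (ZMod 2) (incVec '' K))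
        (single_mem_rootedSpan (H := H) hy))
    rw [incVec_mk, add_assoc, finsupp_zmod_two_add_self, add_zero] at h2
    exact h2

/-- A family of vectors that enter an increasing family of subspaces strictly after their own
time, but lie in the earlier subspace modulo `P`, has at most `dim P` members. -/
lemma card_le_finrank_of_filtration {F M ι : Type*} [Field F] [AddCommGroup M] [Module F M]
    (W : ℝ → Submodule F M) (hW : Monotone W) (P : Submodule F M) [FiniteDimensional F P]
    (t : ι → ℝ) (v : ι → M) (T : Finset ι) (ht : Set.InjOn t T)
    (hnot : ∀ i ∈ T, v i ∉ W (t i)) (hsup : ∀ i ∈ T, v i ∈ W (t i) ⊔ P)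
    (hlater : ∀ i ∈ T, ∀ s, t i < s → v i ∈ W s) : T.card ≤ Module.finrank F P := by
  classical
  have hex : ∀ i, ∃ k, i ∈ T → k ∈ P ∧ v i - k ∈ W (t i) := by
    intro i
    by_cases hi : i ∈ T
    · obtain ⟨w, hw, k, hk, hwk⟩ := Submodule.mem_sup.1 (hsup i hi)
      exact ⟨k, fun _ => ⟨hk, by rwa [← hwk, add_sub_cancel_right]⟩⟩
    · exact ⟨0, fun h => absurd h hi⟩
  choose k hk using hex
  have hind : ∀ R : Finset ι, R ⊆ T → LinearIndepOn F k (R : Set ι) := by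
    intro R
    induction R using Finset.induction_on_max_value t with
    | empty => intro _; simp
    | insert a s has hmax ih =>
      intro hsub
      rw [Finset.coe_insert]
      have haT : a ∈ T := hsub (Finset.mem_insert_self a s)
      refine (ih fun x hx => hsub (Finset.mem_insert_of_mem hx)).insert fun hmem => ?_
      have hle : Submodule.span F (k '' (s : Set ι)) ≤ W (t a) := by
        refine Submodule.span_le.2 ?_
        rintro _ ⟨i, hi, rfl⟩
        have hiT : i ∈ T := hsub (Finset.mem_insert_of_mem hi)
        have hlt : t i < t a := lt_of_le_of_ne (hmax i hi) fun h =>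
          has (ht hiT haT h ▸ hi)
        simpa using (W (t a)).sub_mem (hlater i hiT _ hlt) (hW hlt.le (hk i hiT).2)
      exact hnot a haT (by simpa using (W (t a)).add_mem (hk a haT).2 (hle hmem))
  have hT := hind T subset_rfl
  have hT' : LinearIndependent F (fun i : T => (⟨k i, (hk i i.2).1⟩ : P)) :=
    LinearIndependent.of_comp P.subtype hT
  simpa using hT'.fintype_card_le_finrank

lemma finrank_span_image_le {F M ι : Type*} [Field F] [AddCommGroup M] [Module F M]
    {K : Set ι} (hK : K.Finite) (v : ι → M) :
    Module.finrank F (Submodule.span F (v '' K)) ≤ K.ncard := by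
  classical
  have := finrank_span_finset_le_card (R := F) (hK.image v).toFinset
  rw [Set.Finite.coe_toFinset] at this
  refine this.trans ?_
  rw [← Set.ncard_eq_toFinset_card _ (hK.image v)]
  exact Set.ncard_image_le hK

end Linear

section Levels

variable {V : Type*} {G H : SimpleGraph V} {U : Sym2 V → ℝ}

lemma levelGraph_adj {t : ℝ} {a b : V} :
    (levelGraph G U t).Adj a b ↔ G.Adj a b ∧ U s(a, b) < t := by
  simp only [levelGraph, SimpleGraph.fromEdgeSet_adj, Set.mem_ofPred_eq, SimpleGraph.mem_edgeSet]
  exact ⟨fun h => h.1, fun h => ⟨h, h.1.ne⟩⟩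

lemma mem_edgeSet_levelGraph {t : ℝ} {e : Sym2 V} :
    e ∈ (levelGraph G U t).edgeSet ↔ e ∈ G.edgeSet ∧ U e < t := by
  induction e using Sym2.ind with
  | _ a b => exact levelGraph_adj

lemma levelGraph_le {t : ℝ} : levelGraph G U t ≤ G := fun _ _ h => (levelGraph_adj.1 h).1

lemma levelGraph_mono : Monotone (levelGraph G U) := fun _ _ hst _ _ h =>
  levelGraph_adj.2 ⟨(levelGraph_adj.1 h).1, (levelGraph_adj.1 h).2.trans_le hst⟩

lemma levelGraph_reachable_iff {t : ℝ} {a b : V} :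
    (levelGraph G U t).Reachable a b ↔
      ∃ p : G.Walk a b, p.IsPath ∧ ∀ f ∈ p.edges, U f < t := by
  classical
  constructor
  · rintro ⟨p⟩
    refine ⟨p.toPath.1.mapLe levelGraph_le, p.toPath.2.mapLe levelGraph_le, fun f hf => ?_⟩
    rw [SimpleGraph.Walk.edges_mapLe_eq_edges] at hf
    exact (mem_edgeSet_levelGraph.1 (SimpleGraph.Walk.edges_subset_edgeSet _ hf)).2
  · rintro ⟨p, -, hp⟩
    exact ⟨p.transfer _ fun f hf =>
      mem_edgeSet_levelGraph.2 ⟨p.edges_subset_edgeSet hf, hp f hf⟩⟩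

lemma infVerts_mono {H' : SimpleGraph V} (h : H ≤ H') : infVerts H ⊆ infVerts H' :=
  fun _ ha => Set.Infinite.mono (fun _ hx => SimpleGraph.Reachable.mono h hx) ha

lemma infVerts_of_reachable : ∀ x ∈ infVerts H, ∀ y, H.Reachable x y → y ∈ infVerts H :=
  fun _ hx _ hxy => Set.Infinite.mono (fun _ hz => hxy.symm.trans hz) hx

/-- Adding finitely many edges creates no infinite component free of old infinite ones. -/
lemma exists_reachable_infVerts {K : Set (Sym2 V)} (hK : K.Finite) {x : V}
    (hx : x ∈ infVerts (H ⊔ SimpleGraph.fromEdgeSet K)) :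
    ∃ y ∈ infVerts H, (H ⊔ SimpleGraph.fromEdgeSet K).Reachable x y := by
  by_contra! hcon
  have hfin : ∀ y, (H ⊔ SimpleGraph.fromEdgeSet K).Reachable x y →
      {z | H.Reachable y z}.Finite := fun y hy => by
    by_contra hinf
    exact hcon y hinf hy
  let Z : Set V := insert x {z | (∃ k ∈ K, z ∈ k) ∧
    (H ⊔ SimpleGraph.fromEdgeSet K).Reachable x z}
  have hend : {z | ∃ k ∈ K, z ∈ k}.Finite := by
    have : {z | ∃ k ∈ K, z ∈ k} = ⋃ k ∈ K, {z | z ∈ k} := by ext; simp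
    rw [this]
    refine hK.biUnion fun k _ => ?_
    induction k using Sym2.ind with
    | _ a b => exact (Set.toFinite {a, b}).subset fun z hz => by simpa using hz
  have hZ : Z.Finite := (hend.subset fun z hz => hz.1).insert x
  have hZr : ∀ z ∈ Z, (H ⊔ SimpleGraph.fromEdgeSet K).Reachable x z := by
    rintro z (rfl | hz)
    · exact SimpleGraph.Reachable.refl _
    · exact hz.2
  refine hx ((hZ.biUnion fun z hz => hfin z (hZr z hz)).subset fun y hy => ?_)
  have hy' := (SimpleGraph.reachable_iff_reflTransGen _ _).1 hy
  simp only [Set.mem_iUnion, Set.mem_ofPred_eq]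
  clear hy
  induction hy' with
  | refl => exact ⟨x, Or.inl rfl, SimpleGraph.Reachable.refl _⟩
  | @tail b c hxb hbc ih =>
    rcases hbc with hbc | hbc
    · obtain ⟨z, hz, hzb⟩ := ih
      exact ⟨z, hz, hzb.trans (SimpleGraph.Adj.reachable hbc)⟩
    · refine ⟨c, Or.inr ⟨⟨s(b, c), hbc.1, by simp⟩, ?_⟩, SimpleGraph.Reachable.refl _⟩
      exact ((SimpleGraph.reachable_iff_reflTransGen _ _).2 hxb).trans
        (SimpleGraph.Adj.reachable (Or.inr hbc))

lemma IsRay.reachable {r : ℕ → V} (hr : IsRay H r) (n : ℕ) : H.Reachable (r 0) (r n) := by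
  induction n with
  | zero => exact SimpleGraph.Reachable.refl _
  | succ n ih => exact ih.trans (hr.2 n).reachable

lemma IsRay.mem_infVerts {r : ℕ → V} (hr : IsRay H r) : r 0 ∈ infVerts H :=
  (Set.infinite_range_of_injective hr.1).mono (by rintro _ ⟨n, rfl⟩; exact hr.reachable n)

/-- König's lemma: an infinite component of a locally finite graph contains a ray from each of
its vertices. -/
lemma exists_isRay_of_mem_infVerts (hH : ∀ v, (H.neighborSet v).Finite) {a : V}
    (ha : a ∈ infVerts H) : ∃ r : ℕ → V, IsRay H r ∧ r 0 = a := by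
  let D : V → Set V := fun x => {y | H.Reachable x y ∧ H.dist a y = H.dist a x + H.dist x y}
  let Q : Set V := {x | H.Reachable a x ∧ (D x).Infinite}
  have hstep : ∀ x : Q, ∃ x' : Q, H.Adj x x' ∧ H.dist a x' = H.dist a x + 1 := by
    rintro ⟨x, hax, hx⟩
    by_contra! hcon
    refine hx ((((hH x).subset (Set.inter_subset_left
      (t := {x' | H.dist a x' = H.dist a x + 1}))).biUnion
        (t := D) fun x' hx' => ?_).insert x |>.subset ?_)
    · by_contra hinf
      exact hcon ⟨x', hax.trans (SimpleGraph.Adj.reachable hx'.1), hinf⟩ hx'.1 hx'.2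
    · rintro y ⟨hxy, hd⟩
      obtain ⟨p, hp⟩ := hxy.exists_walk_length_eq_dist
      cases p with
      | nil => exact Or.inl rfl
      | @cons _ x' _ hadj p =>
        rw [SimpleGraph.Walk.length_cons] at hp
        have h1 : H.dist x' y ≤ p.length := SimpleGraph.dist_le p
        obtain ⟨q, hq⟩ := (hax.trans hadj.reachable).exists_walk_length_eq_dist
        obtain ⟨q₀, hq₀⟩ := hax.exists_walk_length_eq_dist
        obtain ⟨q₁, hq₁⟩ := p.reachable.exists_walk_length_eq_dist
        have h2 : H.dist a y ≤ H.dist a x' + H.dist x' y := by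
          simpa [hq, hq₁] using SimpleGraph.dist_le (q.append q₁)
        have h3 : H.dist a x' ≤ H.dist a x + 1 := by
          simpa [hq₀] using SimpleGraph.dist_le (q₀.concat hadj)
        refine Or.inr (Set.mem_biUnion (x := x') ⟨hadj, ?_⟩ ⟨p.reachable, ?_⟩)
        · show H.dist a x' = H.dist a x + 1
          omega
        · omega
  choose nxt hadj hdist using hstep
  have haQ : a ∈ Q := ⟨SimpleGraph.Reachable.refl _, by simpa [D, infVerts] using ha⟩
  let r : ℕ → Q := fun n => nxt^[n] ⟨a, haQ⟩
  have hr : ∀ n, r (n + 1) = nxt (r n) := fun n => Function.iterate_succ_apply' nxt n _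
  have hd : ∀ n, H.dist a (r n) = n := by
    intro n
    induction n with
    | zero => simp [r]
    | succ n ih => rw [hr, hdist, ih]
  refine ⟨fun n => r n, ⟨fun m n hmn => ?_, fun n => ?_⟩, rfl⟩
  · rw [← hd m, ← hd n]
    exact congrArg _ hmn
  · show H.Adj (r n) (r (n + 1))
    rw [hr]
    exact hadj _

lemma IsRay.levelGraph {t : ℝ} {r : ℕ → V} (hr : IsRay G r)
    (h : ∀ f ∈ rayEdges r, U f < t) : IsRay (levelGraph G U t) r :=
  ⟨hr.1, fun n => levelGraph_adj.2 ⟨hr.2 n, h _ ⟨n, rfl⟩⟩⟩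

lemma mem_mstEdges_iff {e : Sym2 V} :
    e ∈ mstEdges G U ↔
      e ∈ G.edgeSet ∧ incVec e ∉ rootedSpan (levelGraph G U (U e)) ∅ := by
  refine and_congr_right fun _ => ?_
  constructor
  · induction e using Sym2.ind with
    | _ a b =>
      intro h hmem
      rw [incVec_mem_rootedSpan_iff (by simp), levelGraph_reachable_iff] at hmem
      obtain ⟨p, hp, hlt⟩ | h' := hmem
      · obtain ⟨f, hf, hle⟩ := h a b rfl p hp
        exact (hlt f hf).not_ge hle
      · exact h'.1
  · rintro h a b rfl p hp
    by_contra! hlt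
    exact h ((incVec_mem_rootedSpan_iff (by simp)).2
      (Or.inl (levelGraph_reachable_iff.2 ⟨p, hp, hlt⟩)))

lemma mem_wmsfEdges_iff (hlf : ∀ v, (G.neighborSet v).Finite) {e : Sym2 V} :
    e ∈ wmsfEdges G U ↔ e ∈ G.edgeSet ∧ incVec e ∉
      rootedSpan (levelGraph G U (U e)) (infVerts (levelGraph G U (U e))) := by
  refine and_congr_right fun _ => ?_
  constructor
  · induction e using Sym2.ind with
    | _ a b =>
      intro h hmem
      obtain ⟨hpath, hrays⟩ := h a b rfl
      rw [incVec_mem_rootedSpan_iff infVerts_of_reachable] at hmem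
      by_cases hab : (levelGraph G U (U s(a, b))).Reachable a b
      · obtain ⟨p, hp, hlt⟩ := levelGraph_reachable_iff.1 hab
        obtain ⟨f, hf, hle⟩ := hpath p hp
        exact (hlt f hf).not_ge hle
      · obtain ⟨ha, hb⟩ := hmem.resolve_left hab
        have hfin : ∀ v, ((levelGraph G U (U s(a, b))).neighborSet v).Finite := fun v =>
          (hlf v).subset fun w hw => levelGraph_le hw
        obtain ⟨r₁, hr₁, h₁⟩ := exists_isRay_of_mem_infVerts hfin ha
        obtain ⟨r₂, hr₂, h₂⟩ := exists_isRay_of_mem_infVerts hfin hb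
        obtain ⟨f, hf, hle⟩ := hrays r₁ r₂ ⟨hr₁.1, fun n => levelGraph_le (hr₁.2 n)⟩
          ⟨hr₂.1, fun n => levelGraph_le (hr₂.2 n)⟩ h₁ h₂ fun m n hmn => hab <| by
            have hm := hr₁.reachable m
            have hn := hr₂.reachable n
            rw [h₁, hmn] at hm
            rw [h₂] at hn
            exact hm.trans hn.symm
        rcases hf with ⟨n, rfl⟩ | ⟨n, rfl⟩
        · exact (levelGraph_adj.1 (hr₁.2 n)).2.not_ge hle
        · exact (levelGraph_adj.1 (hr₂.2 n)).2.not_ge hle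
  · rintro h a b rfl
    rw [incVec_mem_rootedSpan_iff infVerts_of_reachable, not_or] at h
    refine ⟨fun p hp => ?_, ?_⟩
    · by_contra! hlt
      exact h.1 (levelGraph_reachable_iff.2 ⟨p, hp, hlt⟩)
    · rintro r₁ r₂ hr₁ hr₂ rfl rfl -
      by_contra! hlt
      exact h.2 ⟨(hr₁.levelGraph fun f hf => hlt f (Or.inl hf)).mem_infVerts,
        (hr₂.levelGraph fun f hf => hlt f (Or.inr hf)).mem_infVerts⟩

/-- Changing the labels on `K` changes at most `|K|` edges outside `K` of the forest determined
by an admissible choice `S` of vertices wired together in each level graph. -/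
lemma symmDiff_forest_card_le {S : SimpleGraph V → Set V} (hSmono : Monotone S)
    {K : Set (Sym2 V)} (hK : K.Finite)
    (hSsup : ∀ H : SimpleGraph V, ∀ x ∈ S (H ⊔ SimpleGraph.fromEdgeSet K),
      ∃ y ∈ S H, (H ⊔ SimpleGraph.fromEdgeSet K).Reachable x y)
    {U' : Sym2 V → ℝ} (hU : Set.InjOn U G.edgeSet) (hagree : ∀ e ∉ K, U e = U' e)
    {F F' : Set (Sym2 V)}
    (hF : ∀ e, e ∈ F ↔ e ∈ G.edgeSet ∧
      incVec e ∉ rootedSpan (levelGraph G U (U e)) (S (levelGraph G U (U e))))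
    (hF' : ∀ e, e ∈ F' ↔ e ∈ G.edgeSet ∧
      incVec e ∉ rootedSpan (levelGraph G U' (U' e)) (S (levelGraph G U' (U' e)))) :
    (symmDiff F F' \ K).Finite ∧ (symmDiff F F' \ K).ncard ≤ K.ncard := by
  let L : ℝ → SimpleGraph V := levelGraph (G.deleteEdges K) U
  have hlow : ∀ t, L t ≤ levelGraph G U t := fun t a b h => by
    simp only [L, levelGraph_adj, SimpleGraph.deleteEdges_adj] at h ⊢
    exact ⟨h.1.1, h.2⟩
  have hlow' : ∀ t, L t ≤ levelGraph G U' t := fun t a b h => by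
    simp only [L, levelGraph_adj, SimpleGraph.deleteEdges_adj] at h ⊢
    exact ⟨h.1.1, hagree _ h.1.2 ▸ h.2⟩
  have hhigh : ∀ t, levelGraph G U t ≤ L t ⊔ SimpleGraph.fromEdgeSet K := fun t a b h => by
    simp only [L, SimpleGraph.sup_adj, levelGraph_adj, SimpleGraph.deleteEdges_adj,
      SimpleGraph.fromEdgeSet_adj] at h ⊢
    by_cases hk : s(a, b) ∈ K
    · exact Or.inr ⟨hk, h.1.ne⟩
    · exact Or.inl ⟨⟨h.1, hk⟩, h.2⟩
  have hhigh' : ∀ t, levelGraph G U' t ≤ L t ⊔ SimpleGraph.fromEdgeSet K := fun t a b h => by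
    simp only [L, SimpleGraph.sup_adj, levelGraph_adj, SimpleGraph.deleteEdges_adj,
      SimpleGraph.fromEdgeSet_adj] at h ⊢
    by_cases hk : s(a, b) ∈ K
    · exact Or.inr ⟨hk, h.1.ne⟩
    · exact Or.inl ⟨⟨h.1, hk⟩, (hagree _ hk).symm ▸ h.2⟩
  let W : ℝ → Submodule (ZMod 2) (V →₀ ZMod 2) := fun t => rootedSpan (L t) (S (L t))
  let P : Submodule (ZMod 2) (V →₀ ZMod 2) := Submodule.span (ZMod 2) (incVec '' K)
  have hWmono : Monotone W := fun s t hst =>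
    rootedSpan_mono (levelGraph_mono hst) (hSmono (levelGraph_mono hst))
  have hge : ∀ {t : ℝ} {H : SimpleGraph V}, L t ≤ H → W t ≤ rootedSpan H (S H) :=
    fun h => rootedSpan_mono h (hSmono h)
  have hle : ∀ {t : ℝ} {H : SimpleGraph V}, H ≤ L t ⊔ SimpleGraph.fromEdgeSet K →
      rootedSpan H (S H) ≤ W t ⊔ P :=
    fun h => (rootedSpan_mono h (hSmono h)).trans (rootedSpan_sup_le (hSsup _))
  have hmain : ∀ e ∈ symmDiff F F' \ K,
      e ∈ G.edgeSet ∧ incVec e ∉ W (U e) ∧ incVec e ∈ W (U e) ⊔ P := by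
    rintro e ⟨⟨h, h'⟩ | ⟨h, h'⟩, hek⟩
    · rw [hF] at h
      rw [hF', ← hagree e hek, not_and, not_not] at h'
      exact ⟨h.1, fun hw => h.2 (hge (hlow _) hw), hle (hhigh' _) (h' h.1)⟩
    · rw [hF', ← hagree e hek] at h
      rw [hF, not_and, not_not] at h'
      exact ⟨h.1, fun hw => h.2 (hge (hlow' _) hw), hle (hhigh _) (h' h.1)⟩
  have hPfin : FiniteDimensional (ZMod 2) P :=
    FiniteDimensional.span_of_finite _ (hK.image incVec)
  have hcard : ∀ T : Finset (Sym2 V), (T : Set (Sym2 V)) ⊆ symmDiff F F' \ K →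
      T.card ≤ K.ncard := fun T hT =>
    (card_le_finrank_of_filtration W hWmono P U incVec T
      (fun e he f hf h => hU (hmain e (hT he)).1 (hmain f (hT hf)).1 h)
      (fun e he => (hmain e (hT he)).2.1) (fun e he => (hmain e (hT he)).2.2)
      (fun e he s hs => incVec_mem_rootedSpan_of_edge (mem_edgeSet_levelGraph.2
        ⟨by rw [SimpleGraph.edgeSet_deleteEdges]; exact ⟨(hmain e (hT he)).1, (hT he).2⟩,
          hs⟩))).trans
      (finrank_span_image_le hK incVec)
  have hfin : (symmDiff F F' \ K).Finite := by
    by_contra hinf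
    obtain ⟨T, hT, hTc⟩ := Set.Infinite.exists_subset_card_eq hinf (K.ncard + 1)
    have := hcard T hT
    omega
  refine ⟨hfin, ?_⟩
  rw [Set.ncard_eq_toFinset_card _ hfin]
  exact hcard _ (by simp)

end Levels

lemma exists_subset_pair_of_ncard_diff_le_one {α : Type*} {A : Set α} {e : α}
    (hfin : (A \ {e}).Finite) (hcard : (A \ {e}).ncard ≤ 1) : ∃ g, A ⊆ {e, g} := by
  rcases (A \ {e}).eq_empty_or_nonempty with h | ⟨g, hg⟩
  · exact ⟨e, fun x hx => by simpa using Set.sdiff_eq_empty.1 h hx⟩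
  · refine ⟨g, fun x hx => ?_⟩
    by_cases hxe : x = e
    · exact Or.inl hxe
    · exact Or.inr ((Set.ncard_le_one hfin).1 hcard x ⟨hx, hxe⟩ g hg)

/-- If two injective labelings of an infinite locally finite graph
agree outside a finite set `K` of edges, then outside `K` the free (resp. wired)
minimal spanning forests differ in at most `|K|` edges.  In particular, changing
the label of a single edge `e` changes each forest at most at `e` and at one
other edge. -/
theorem stmt11 {V : Type*} [Infinite V] (G : SimpleGraph V)
    (hlf : ∀ v : V, (G.neighborSet v).Finite)
    (K : Set (Sym2 V)) (hK : K.Finite)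
    (U U' : Sym2 V → ℝ) (hU : Set.InjOn U G.edgeSet) (hU' : Set.InjOn U' G.edgeSet)
    (hagree : ∀ e ∉ K, U e = U' e) :
    ((symmDiff (mstEdges G U) (mstEdges G U')) \ K).Finite ∧
    ((symmDiff (mstEdges G U) (mstEdges G U')) \ K).ncard ≤ K.ncard ∧
    ((symmDiff (wmsfEdges G U) (wmsfEdges G U')) \ K).Finite ∧
    ((symmDiff (wmsfEdges G U) (wmsfEdges G U')) \ K).ncard ≤ K.ncard ∧
    (∀ e : Sym2 V, K = {e} →
      (∃ g : Sym2 V, symmDiff (mstEdges G U) (mstEdges G U') ⊆ {e, g}) ∧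
      (∃ g : Sym2 V, symmDiff (wmsfEdges G U) (wmsfEdges G U') ⊆ {e, g})) := by
  obtain ⟨hf, hfc⟩ := symmDiff_forest_card_le (S := fun _ => ∅) monotone_const hK
    (fun _ x hx => hx.elim) hU hagree (fun _ => mem_mstEdges_iff) (fun _ => mem_mstEdges_iff)
  obtain ⟨hw, hwc⟩ := symmDiff_forest_card_le (S := infVerts) (fun _ _ h => infVerts_mono h) hK
    (fun _ _ hx => exists_reachable_infVerts hK hx) hU hagree
    (fun _ => mem_wmsfEdges_iff hlf) (fun _ => mem_wmsfEdges_iff hlf)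
  refine ⟨hf, hfc, hw, hwc, ?_⟩
  rintro e rfl
  rw [Set.ncard_singleton] at hfc hwc
  exact ⟨exists_subset_pair_of_ncard_diff_le_one hf hfc,
    exists_subset_pair_of_ncard_diff_le_one hw hwc⟩
end

section
/- Let G be an infinite, locally finite, connected simple graph with countable edge set E, and let (U(e))_{e ∈ E} be i.i.d. uniform [0,1] random variables under the product measure P on [0,1]^E. Then P[F_f(U) = F_w(U)] = 1 if and only if G has almost everywhere uniqueness, i.e., for Lebesgue-almost every p ∈ (0,1), P-almost surely the spanning subgraph with edge set {e ∈ E : U(e) < p} has at most one infinite connected component. -/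
open SimpleGraph

open MeasureTheory

open Filter

section Deterministic

variable {V : Type*} {G : SimpleGraph V}

/-- The vertices `x` and `y` lie in two distinct infinite connected components of the spanning
graph with edge set `S`. -/
def InfSep (S : Set (Sym2 V)) (x y : V) : Prop :=
  {z | (fromEdgeSet S).Reachable x z}.Infinite ∧
    {z | (fromEdgeSet S).Reachable y z}.Infinite ∧ ¬ (fromEdgeSet S).Reachable x y

theorem InfSep.symm {S : Set (Sym2 V)} {x y : V} (h : InfSep S x y) : InfSep S y x :=
  ⟨h.2.1, h.1, fun hr => h.2.2 hr.symm⟩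

theorem reachable_fromEdgeSet_sep_iff {P : Sym2 V → Prop} {x y : V} :
    (fromEdgeSet {e | e ∈ G.edgeSet ∧ P e}).Reachable x y ↔
      ∃ p : G.Walk x y, p.IsPath ∧ ∀ e ∈ p.edges, P e := by
  constructor
  · intro h
    obtain ⟨p, hp⟩ := h.exists_isPath
    have key : ∀ e ∈ p.edges, e ∈ G.edgeSet ∧ P e := fun e he => by
      have := p.edges_subset_edgeSet he
      rw [edgeSet_fromEdgeSet] at this
      exact this.1
    refine ⟨p.transfer G fun e he => (key e he).1, hp.transfer _, fun e he => ?_⟩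
    rw [Walk.edges_transfer] at he
    exact (key e he).2
  · rintro ⟨p, -, hp⟩
    refine ⟨p.transfer _ fun e he => ?_⟩
    have hG := p.edges_subset_edgeSet he
    rw [edgeSet_fromEdgeSet]
    exact ⟨⟨hG, hp e he⟩, G.not_isDiag_of_mem_edgeSet hG⟩

theorem exists_isRay_of_infinite_reachable {H : SimpleGraph V}
    (hlf : ∀ v, (H.neighborSet v).Finite) {x : V} (hx : {z | H.Reachable x z}.Infinite) :
    ∃ r : ℕ → V, IsRay H r ∧ r 0 = x := by
  let D : V → Set V := fun v => {z | ∃ p : H.Walk v z, H.dist x v + p.length = H.dist x z}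
  have step : ∀ v : {v // H.Reachable x v ∧ (D v).Infinite},
      ∃ w : {v // H.Reachable x v ∧ (D v).Infinite},
        H.Adj v w ∧ H.dist x w = H.dist x v + 1 := by
    rintro ⟨v, hv, hD⟩
    have hsub : D v ⊆ {v} ∪ ⋃ w ∈ {w ∈ H.neighborSet v | H.dist x w = H.dist x v + 1}, D w := by
      rintro z ⟨p, hp⟩
      cases p with
      | nil => exact Or.inl rfl
      | @cons _ w _ h q =>
        right
        have hw : H.Reachable x w := hv.trans h.reachable
        have h1 : H.dist x w ≤ H.dist x v + 1 := by
          obtain ⟨a, ha⟩ := hv.exists_walk_length_eq_dist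
          have := dist_le (a.concat h)
          rwa [Walk.length_concat, ha] at this
        have h2 : H.dist x z ≤ H.dist x w + q.length := by
          obtain ⟨a, ha⟩ := hw.exists_walk_length_eq_dist
          have := dist_le (a.append q)
          rwa [Walk.length_append, ha] at this
        rw [Walk.length_cons] at hp
        simp only [Set.mem_iUnion]
        exact ⟨w, ⟨h, by omega⟩, q, by omega⟩
    by_contra! hcon
    refine hD (((Set.finite_singleton v).union
      (((hlf v).subset (Set.sep_subset _ _)).biUnion fun w hw => ?_)).subset hsub)
    by_contra hinf
    exact hcon ⟨w, hv.trans (Adj.reachable hw.1), hinf⟩ hw.1 hw.2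
  choose f hf using step
  have hx0 : (D x).Infinite := by
    refine hx.mono fun z hz => ?_
    obtain ⟨p, hp⟩ := Reachable.exists_walk_length_eq_dist hz
    exact ⟨p, by simp [hp]⟩
  let s : ℕ → {v // H.Reachable x v ∧ (D v).Infinite} := fun n => f^[n] ⟨x, .refl _, hx0⟩
  have hs : ∀ n, s (n + 1) = f (s n) := fun n => Function.iterate_succ_apply' _ _ _
  have hdist : ∀ n, H.dist x (s n) = n := by
    intro n
    induction n with
    | zero => simp [s]
    | succ n ih => rw [hs, (hf _).2, ih]
  refine ⟨fun n => s n, ⟨fun m n h => ?_, fun n => ?_⟩, rfl⟩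
  · rw [← hdist m, ← hdist n]
    exact congrArg _ h
  · change H.Adj (s n) (s (n + 1))
    rw [hs]
    exact (hf _).1

theorem reachable_of_isRay {H : SimpleGraph V} {r : ℕ → V} (h : ∀ n, H.Adj (r n) (r (n + 1)))
    (n : ℕ) : H.Reachable (r 0) (r n) := by
  induction n with
  | zero => exact .refl _
  | succ n ih => exact ih.trans (h n).reachable

theorem exists_isRay_sep (hlf : ∀ v, (G.neighborSet v).Finite) {P : Sym2 V → Prop} {x : V}
    (hx : {z | (fromEdgeSet {e | e ∈ G.edgeSet ∧ P e}).Reachable x z}.Infinite) :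
    ∃ r : ℕ → V, IsRay G r ∧ r 0 = x ∧ (∀ e ∈ rayEdges r, P e) ∧
      ∀ n, (fromEdgeSet {e | e ∈ G.edgeSet ∧ P e}).Reachable x (r n) := by
  obtain ⟨r, hr, rfl⟩ := exists_isRay_of_infinite_reachable
    (fun v => (hlf v).subset fun w hw => ((fromEdgeSet_adj _).1 hw).1.1) hx
  have hadj := fun n => (fromEdgeSet_adj _).1 (hr.2 n)
  refine ⟨r, ⟨hr.1, fun n => (hadj n).1.1⟩, rfl, ?_, reachable_of_isRay hr.2⟩
  rintro e ⟨n, rfl⟩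
  exact (hadj n).1.2

theorem infinite_reachable_of_isRay {P : Sym2 V → Prop} {r : ℕ → V} (hr : IsRay G r)
    (hP : ∀ e ∈ rayEdges r, P e) :
    {z | (fromEdgeSet {e | e ∈ G.edgeSet ∧ P e}).Reachable (r 0) z}.Infinite := by
  refine (Set.infinite_range_of_injective hr.1).mono ?_
  rintro _ ⟨n, rfl⟩
  refine reachable_of_isRay (fun n => ?_) n
  exact (fromEdgeSet_adj _).2 ⟨⟨hr.2 n, hP _ (Set.mem_range_self n)⟩, (hr.2 n).ne⟩

/-- An edge belongs to the free but not to the wired minimal spanning forest exactly when its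
endpoints lie in distinct infinite clusters of the edges with smaller labels. -/
theorem mstEdges_eq_wmsfEdges_iff (hlf : ∀ v, (G.neighborSet v).Finite) (U : Sym2 V → ℝ) :
    mstEdges G U = wmsfEdges G U ↔
      ∀ x y, G.Adj x y → ¬ InfSep {e | e ∈ G.edgeSet ∧ U e < U s(x, y)} x y := by
  constructor
  · intro heq x y hxy hsep
    have hmem : s(x, y) ∈ mstEdges G U := by
      refine ⟨hxy, fun a b hab p hp => ?_⟩
      by_contra! hcon
      have hr := reachable_fromEdgeSet_sep_iff.2 ⟨p, hp, hcon⟩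
      rcases Sym2.eq_iff.1 hab with ⟨rfl, rfl⟩ | ⟨rfl, rfl⟩
      · exact hsep.2.2 hr
      · exact hsep.2.2 hr.symm
    rw [heq] at hmem
    obtain ⟨r₁, h₁, h₁0, h₁P, h₁r⟩ := exists_isRay_sep hlf hsep.1
    obtain ⟨r₂, h₂, h₂0, h₂P, h₂r⟩ := exists_isRay_sep hlf hsep.2.1
    obtain ⟨f, hf, hle⟩ := (hmem.2 x y rfl).2 r₁ r₂ h₁ h₂ h₁0 h₂0 fun m n hmn =>
      hsep.2.2 ((h₁r m).trans (hmn ▸ (h₂r n).symm))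
    exact hle.not_gt (hf.elim (h₁P f) (h₂P f))
  · intro h
    refine Set.Subset.antisymm (fun e he => ⟨he.1, ?_⟩) fun e he =>
      ⟨he.1, fun a b hab => (he.2 a b hab).1⟩
    rintro a b rfl
    refine ⟨he.2 a b rfl, fun r₁ r₂ h₁ h₂ h₁0 h₂0 _ => ?_⟩
    by_contra! hcon
    subst h₁0 h₂0
    refine h _ _ he.1 ⟨infinite_reachable_of_isRay h₁ fun e he => hcon e (.inl he),
      infinite_reachable_of_isRay h₂ fun e he => hcon e (.inr he), fun hr => ?_⟩
    obtain ⟨p, hp, hlt⟩ := reachable_fromEdgeSet_sep_iff.1 hr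
    obtain ⟨f, hf, hle⟩ := he.2 _ _ rfl p hp
    exact hle.not_gt (hlt f hf)

theorem reachable_of_reachable_insert {S : Set (Sym2 V)} {x u v z : V}
    (h : (fromEdgeSet (insert s(x, u) S)).Reachable v z) :
    (fromEdgeSet S).Reachable v z ∨ (fromEdgeSet S).Reachable x z ∨
      (fromEdgeSet S).Reachable u z := by
  obtain ⟨p⟩ := h
  induction p with
  | nil => exact .inl (.refl _)
  | @cons a b c hab q ih =>
    rcases ih with ih | ih
    · obtain ⟨hmem, hne⟩ := (fromEdgeSet_adj _).1 hab
      rcases hmem with hmem | hmem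
      · rcases Sym2.eq_iff.1 hmem with ⟨rfl, rfl⟩ | ⟨rfl, rfl⟩
        · exact .inr (.inr ih)
        · exact .inr (.inl ih)
      · exact .inl ((Adj.reachable ((fromEdgeSet_adj _).2 ⟨hmem, hne⟩)).trans ih)
    · exact .inr ih

theorem infinite_reachable_congr {H : SimpleGraph V} {x y : V} (h : H.Reachable x y)
    (hx : {z | H.Reachable x z}.Infinite) : {z | H.Reachable y z}.Infinite :=
  hx.mono fun _ hz => h.symm.trans hz

/-- If no finite set of edges can be added to `S` so as to create an edge of `G` which joins
distinct infinite components once it is removed, then `S` has at most one infinite component. -/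
theorem reachable_of_forall_not_infSep {x y : V} (p : G.Walk x y) (S : Set (Sym2 V))
    (hS : ∀ (F : Finset (Sym2 V)), ↑F ⊆ G.edgeSet → ∀ a b, G.Adj a b →
      ¬ InfSep ((S ∪ F) \ {s(a, b)}) a b)
    (hx : {z | (fromEdgeSet S).Reachable x z}.Infinite)
    (hy : {z | (fromEdgeSet S).Reachable y z}.Infinite) :
    (fromEdgeSet S).Reachable x y := by
  classical
  induction p generalizing S with
  | nil => exact .refl _
  | @cons x u y h q ih =>
    by_contra hxy
    have hmono : fromEdgeSet S ≤ fromEdgeSet (insert s(x, u) S) :=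
      fromEdgeSet_mono (Set.subset_insert _ _)
    have hxu : (fromEdgeSet (insert s(x, u) S)).Reachable x u :=
      Adj.reachable ((fromEdgeSet_adj _).2 ⟨Set.mem_insert _ _, h.ne⟩)
    have huy := ih (insert s(x, u) S)
      (fun F hF a b hab => by
        have := hS (insert s(x, u) F) (by
          rw [Finset.coe_insert]
          exact Set.insert_subset h hF) a b hab
        rwa [Finset.coe_insert, Set.union_insert, ← Set.insert_union] at this)
      (infinite_reachable_congr hxu (hx.mono fun z hz => Reachable.mono hmono hz))
      (hy.mono fun z hz => Reachable.mono hmono hz)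
    have huy' : (fromEdgeSet S).Reachable u y := by
      rcases reachable_of_reachable_insert huy with h' | h' | h'
      · exact h'
      · exact absurd h' hxy
      · exact h'
    have hnot : ¬ (fromEdgeSet S).Reachable x u := fun h' => hxy (h'.trans huy')
    have hmem : s(x, u) ∉ S := fun h' =>
      hnot (Adj.reachable ((fromEdgeSet_adj _).2 ⟨h', h.ne⟩))
    refine hS ∅ (by simp) x u h ?_
    rw [Finset.coe_empty, Set.union_empty, Set.sdiff_singleton_eq_self hmem]
    exact ⟨hx, infinite_reachable_congr huy'.symm hy, hnot⟩

end Deterministic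

section Measurability

variable {V Ω : Type*} [MeasurableSpace Ω]

theorem measurableSet_reachable_fromEdgeSet [Countable V] {S : Ω → Set (Sym2 V)}
    (hS : ∀ e, MeasurableSet {ω | e ∈ S ω}) (x y : V) :
    MeasurableSet {ω | (fromEdgeSet (S ω)).Reachable x y} := by
  have hcount : Countable ((⊤ : SimpleGraph V).Walk x y) :=
    Function.Injective.countable (f := Walk.support) fun _ _ => Walk.ext_support
  have heq : {ω | (fromEdgeSet (S ω)).Reachable x y} =
      ⋃ (p : (⊤ : SimpleGraph V).Walk x y) (_ : p.IsPath), ⋂ e ∈ {e | e ∈ p.edges},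
        {ω | e ∈ S ω} := by
    ext ω
    have hω : fromEdgeSet (S ω) =
        fromEdgeSet {e | e ∈ (⊤ : SimpleGraph V).edgeSet ∧ e ∈ S ω} := by
      ext a b
      simp only [fromEdgeSet_adj, Set.mem_ofPred_eq, mem_edgeSet, top_adj]
      tauto
    simp only [Set.mem_ofPred_eq, Set.mem_iUnion, Set.mem_iInter, exists_prop]
    rw [hω, reachable_fromEdgeSet_sep_iff]
  rw [heq]
  exact .iUnion fun p => .iUnion fun _ =>
    .biInter (List.finite_toSet p.edges).countable fun e _ => hS e

theorem measurableSet_infinite_setOf {ι : Type*} [Countable ι] {P : Ω → ι → Prop}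
    (hP : ∀ i, MeasurableSet {ω | P ω i}) : MeasurableSet {ω | {i | P ω i}.Infinite} := by
  have heq : {ω | {i | P ω i}.Infinite} =
      ⋂ F : Finset ι, ⋃ (i : ι) (_ : i ∉ F), {ω | P ω i} := by
    ext ω
    simp only [Set.mem_ofPred_eq, Set.mem_iUnion, Set.mem_iInter, exists_prop]
    refine ⟨fun h F => ?_, fun h hfin => ?_⟩
    · obtain ⟨i, hi, hF⟩ := h.exists_notMem_finset F
      exact ⟨i, hF, hi⟩
    · obtain ⟨i, hi, hi'⟩ := h hfin.toFinset
      exact hi (hfin.mem_toFinset.2 hi')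
  rw [heq]
  exact .iInter fun F => .iUnion fun i => .iUnion fun _ => hP i

theorem measurableSet_infSep [Countable V] {S : Ω → Set (Sym2 V)}
    (hS : ∀ e, MeasurableSet {ω | e ∈ S ω}) (x y : V) :
    MeasurableSet {ω | InfSep (S ω) x y} :=
  (measurableSet_infinite_setOf fun z => measurableSet_reachable_fromEdgeSet hS x z).inter
    ((measurableSet_infinite_setOf fun z => measurableSet_reachable_fromEdgeSet hS y z).inter
      (measurableSet_reachable_fromEdgeSet hS x y).compl)

end Measurability

section Resampling

/-- Resampling one coordinate preserves a product measure. -/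
theorem measurePreserving_update_of_pi {ι : Type*} [DecidableEq ι] {μ : Measure (ι → ℝ)} [SFinite μ]
    {ν : Measure ℝ} [IsProbabilityMeasure ν]
    (h : ∀ (s : Finset ι) (t : ι → Set ℝ), (∀ e, MeasurableSet (t e)) →
      μ {U | ∀ e ∈ s, U e ∈ t e} = ∏ e ∈ s, ν (t e)) (e : ι) :
    MeasurePreserving (fun q : ℝ × (ι → ℝ) => Function.update q.2 e q.1) (ν.prod μ) μ := by
  have hm : Measurable fun q : ℝ × (ι → ℝ) => Function.update q.2 e q.1 := by
    refine measurable_pi_lambda _ fun i => ?_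
    by_cases hi : i = e
    · subst hi
      simpa using measurable_fst
    · simp only [Function.update_of_ne hi]
      exact (measurable_pi_apply i).comp measurable_snd
  refine ⟨hm, ?_⟩
  have hμ : μ = Measure.infinitePi fun _ : ι => ν :=
    Measure.eq_infinitePi _ fun s t ht => h s t ht
  refine (Measure.eq_infinitePi (fun _ : ι => ν) fun s t ht => ?_).trans hμ.symm
  rw [Measure.map_apply hm (.pi s.countable_toSet fun i _ => ht i)]
  by_cases he : e ∈ s
  · have hpre : (fun q : ℝ × (ι → ℝ) => Function.update q.2 e q.1) ⁻¹' (Set.pi s t) =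
        t e ×ˢ {U | ∀ i ∈ s.erase e, U i ∈ t i} := by
      ext ⟨a, U⟩
      simp only [Set.mem_preimage, Set.mem_pi, Set.mem_prod, Set.mem_ofPred_eq, Finset.mem_coe,
        Finset.mem_erase]
      refine ⟨fun H => ⟨by simpa using H e he, fun i hi => by
        simpa [Function.update_of_ne hi.1] using H i hi.2⟩, fun H i hi => ?_⟩
      by_cases hie : i = e
      · subst hie
        simpa using H.1
      · simpa [Function.update_of_ne hie] using H.2 i ⟨hie, hi⟩
    rw [hpre, Measure.prod_prod, h _ _ ht, Finset.mul_prod_erase s (fun i => ν (t i)) he]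
  · have hpre : (fun q : ℝ × (ι → ℝ) => Function.update q.2 e q.1) ⁻¹' (Set.pi s t) =
        Set.univ ×ˢ {U | ∀ i ∈ s, U i ∈ t i} := by
      ext ⟨a, U⟩
      simp only [Set.mem_preimage, Set.mem_pi, Set.mem_prod, Set.mem_ofPred_eq, Finset.mem_coe,
        Set.mem_univ, true_and]
      refine forall₂_congr fun i hi => ?_
      rw [Function.update_of_ne (ne_of_mem_of_not_mem hi he)]
    rw [hpre, Measure.prod_prod, h _ _ ht, measure_univ, one_mul]

theorem ae_iff_ae_ae_update {ι : Type*} [DecidableEq ι] {μ : Measure (ι → ℝ)} [SFinite μ] {ν : Measure ℝ}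
    [SFinite ν] {e : ι}
    (h : MeasurePreserving (fun q : ℝ × (ι → ℝ) => Function.update q.2 e q.1) (ν.prod μ) μ)
    {p : (ι → ℝ) → Prop} (hp : MeasurableSet {U | p U}) :
    (∀ᵐ U ∂μ, p U) ↔ ∀ᵐ t ∂ν, ∀ᵐ U ∂μ, p (Function.update U e t) := by
  rw [← Measure.ae_prod_iff_ae_ae (p := fun q : ℝ × (ι → ℝ) => p (Function.update q.2 e q.1))
    (h.measurable hp)]
  conv_lhs => rw [← h.map_eq]
  exact ae_map_iff h.measurable.aemeasurable hp

end Resampling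

section Percolation

theorem measurableSet_mem_percolation {V : Type*} (G : SimpleGraph V) (p : ℝ) (F : Set (Sym2 V)) (f : Sym2 V) :
    MeasurableSet {U : Sym2 V → ℝ | f ∈ {f | f ∈ G.edgeSet ∧ (U f < p ∨ f ∈ F)}} :=
  (MeasurableSet.const _).inter
    ((measurableSet_lt (measurable_pi_apply f) measurable_const).union (.const _))

variable {V : Type*} (G : SimpleGraph V) {μ : Measure (Sym2 V → ℝ)} [SFinite μ]

theorem ae_not_infSep_lt_label_iff [Countable V] [DecidableEq V] {ν : Measure ℝ} [SFinite ν] {x y : V}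
    (h : MeasurePreserving (fun q : ℝ × (Sym2 V → ℝ) => Function.update q.2 s(x, y) q.1)
      (ν.prod μ) μ) :
    (∀ᵐ U ∂μ, ¬ InfSep {f | f ∈ G.edgeSet ∧ U f < U s(x, y)} x y) ↔
      ∀ᵐ p ∂ν, ∀ᵐ U ∂μ, ¬ InfSep ({f | f ∈ G.edgeSet ∧ U f < p} \ {s(x, y)}) x y := by
  rw [ae_iff_ae_ae_update h]
  · refine eventually_congr (.of_forall fun p => eventually_congr (.of_forall fun U => ?_))
    suffices heq : {f | f ∈ G.edgeSet ∧ Function.update U s(x, y) p f <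
        Function.update U s(x, y) p s(x, y)} =
        {f | f ∈ G.edgeSet ∧ U f < p} \ {s(x, y)} by rw [heq]
    ext f
    by_cases hf : f = s(x, y)
    · subst hf
      simp
    · simp [hf]
  · refine (measurableSet_infSep (fun f => ?_) x y).compl
    exact (MeasurableSet.const _).inter
      (measurableSet_lt (measurable_pi_apply f) (measurable_pi_apply _))

/-- Insertion tolerance of percolation. -/
theorem ae_percolation_insert [DecidableEq V] {ν : Measure ℝ} [SFinite ν] {e : Sym2 V} {p : ℝ}
    (h : MeasurePreserving (fun q : ℝ × (Sym2 V → ℝ) => Function.update q.2 e q.1) (ν.prod μ) μ)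
    (hp : ν (Set.Iio p) ≠ 0) {Q : Set (Sym2 V) → Prop} {F : Set (Sym2 V)}
    (hQ : MeasurableSet {U : Sym2 V → ℝ | Q {f | f ∈ G.edgeSet ∧ (U f < p ∨ f ∈ F)}})
    (hae : ∀ᵐ U ∂μ, Q {f | f ∈ G.edgeSet ∧ (U f < p ∨ f ∈ F)}) :
    ∀ᵐ U ∂μ, Q {f | f ∈ G.edgeSet ∧ (U f < p ∨ f ∈ insert e F)} := by
  rw [ae_iff_ae_ae_update h hQ] at hae
  obtain ⟨t, htp, ht⟩ := ((frequently_ae_iff.2 hp).and_eventually hae).exists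
  filter_upwards [ht] with U hU
  convert hU using 3 with f
  by_cases hf : f = e
  · subst hf
    simp_all
  · simp [hf]

/-- Deletion tolerance of percolation. -/
theorem ae_percolation_diff [Countable V] [DecidableEq V] {ν : Measure ℝ} [SFinite ν] {e : Sym2 V} {p : ℝ}
    (h : MeasurePreserving (fun q : ℝ × (Sym2 V → ℝ) => Function.update q.2 e q.1) (ν.prod μ) μ)
    (hp : ν (Set.Ioi p) ≠ 0) {Q : Set (Sym2 V) → Prop}
    (hQ : MeasurableSet {U : Sym2 V → ℝ | Q {f | f ∈ G.edgeSet ∧ U f < p}})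
    (hae : ∀ᵐ U ∂μ, Q {f | f ∈ G.edgeSet ∧ U f < p}) :
    ∀ᵐ U ∂μ, Q ({f | f ∈ G.edgeSet ∧ U f < p} \ {e}) := by
  rw [ae_iff_ae_ae_update h hQ] at hae
  obtain ⟨t, htp, ht⟩ := ((frequently_ae_iff.2 hp).and_eventually hae).exists
  filter_upwards [ht] with U hU
  convert hU using 1
  ext f
  by_cases hf : f = e
  · subst hf
    have : ¬ t < p := (Set.mem_Ioi.1 htp).not_gt
    simp [this]
  · simp [hf]

/-- At level `p`, uniqueness of the infinite cluster is equivalent to the absence of edges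
whose removal leaves their endpoints in distinct infinite clusters. -/
theorem ae_forall_not_infSep_diff_iff [Countable V] [DecidableEq V] (hG : G.Connected) {ν : Measure ℝ} [SFinite ν]
    (h : ∀ e, MeasurePreserving (fun q : ℝ × (Sym2 V → ℝ) => Function.update q.2 e q.1)
      (ν.prod μ) μ) {p : ℝ} (hp : ν (Set.Iio p) ≠ 0) (hp' : ν (Set.Ioi p) ≠ 0) :
    (∀ x y, G.Adj x y →
      ∀ᵐ U ∂μ, ¬ InfSep ({f | f ∈ G.edgeSet ∧ U f < p} \ {s(x, y)}) x y) ↔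
      ∀ᵐ U ∂μ, ∀ x y, ¬ InfSep {f | f ∈ G.edgeSet ∧ U f < p} x y := by
  constructor
  · intro H
    have H' : ∀ (F : Finset (Sym2 V)) (x y), G.Adj x y → ∀ᵐ U ∂μ,
        ¬ InfSep ({f | f ∈ G.edgeSet ∧ (U f < p ∨ f ∈ (F : Set (Sym2 V)))} \ {s(x, y)}) x y := by
      intro F x y hxy
      induction F using Finset.induction_on with
      | empty => simpa using H x y hxy
      | insert e F _ ih =>
        rw [Finset.coe_insert]
        refine ae_percolation_insert G (h e) hp (Q := fun S => ¬ InfSep (S \ {s(x, y)}) x y) ?_ ih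
        exact (measurableSet_infSep (fun f =>
          (measurableSet_mem_percolation G p F f).inter (.const _)) x y).compl
    have H'' : ∀ᵐ U ∂μ, ∀ (F : Finset (Sym2 V)) (x y), G.Adj x y →
        ¬ InfSep ({f | f ∈ G.edgeSet ∧ (U f < p ∨ f ∈ (F : Set (Sym2 V)))} \ {s(x, y)}) x y := by
      simp only [ae_all_iff]
      exact H'
    filter_upwards [H''] with U hU x y hsep
    obtain ⟨w⟩ := hG.preconnected x y
    refine hsep.2.2 (reachable_of_forall_not_infSep w _ (fun F hF a b hab => ?_) hsep.1 hsep.2.1)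
    convert hU F a b hab using 3
    ext f
    have := @hF f
    simp only [Set.mem_union, Set.mem_ofPred_eq]
    tauto
  · intro H x y _
    refine ae_percolation_diff G (h s(x, y)) hp' (Q := fun S => ¬ InfSep S x y) ?_
      (H.mono fun U hU => hU x y)
    refine (measurableSet_infSep (fun f => ?_) x y).compl
    simpa using measurableSet_mem_percolation G p ∅ f

end Percolation

/-- With i.i.d. uniform `[0,1]` labels, the free and wired minimal
spanning forests coincide a.s. iff `G` has almost everywhere uniqueness: for
Lebesgue-a.e. `p ∈ (0,1)`, a.s. the subgraph `{e : U(e) < p}` has at most one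
infinite connected component. -/
theorem stmt13 {V : Type*} [Infinite V] [Countable V] (G : SimpleGraph V)
    (hlf : ∀ v : V, (G.neighborSet v).Finite) (hG : G.Connected)
    (μ : Measure (Sym2 V → ℝ)) [IsProbabilityMeasure μ]
    (hiid : ∀ (s : Finset (Sym2 V)) (t : Sym2 V → Set ℝ), (∀ e, MeasurableSet (t e)) →
      μ {U : Sym2 V → ℝ | ∀ e ∈ s, U e ∈ t e} = ∏ e ∈ s, volume (t e ∩ Set.Icc 0 1)) :
    μ {U : Sym2 V → ℝ | mstEdges G U = wmsfEdges G U} = 1 ↔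
      ∀ᵐ p ∂(volume.restrict (Set.Ioo (0 : ℝ) 1)),
        μ {U : Sym2 V → ℝ | ∀ x y : V,
          {z : V | (SimpleGraph.fromEdgeSet {e | e ∈ G.edgeSet ∧ U e < p}).Reachable x z}.Infinite →
          {z : V | (SimpleGraph.fromEdgeSet {e | e ∈ G.edgeSet ∧ U e < p}).Reachable y z}.Infinite →
          (SimpleGraph.fromEdgeSet {e | e ∈ G.edgeSet ∧ U e < p}).Reachable x y} = 1 := by
  classical
  set ν : Measure ℝ := volume.restrict (Set.Ioo 0 1) with hν
  have hν' : ν = volume.restrict (Set.Icc 0 1) := restrict_Ioo_eq_restrict_Icc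
  have : IsProbabilityMeasure ν := ⟨by simp [hν]⟩
  have hupd := measurePreserving_update_of_pi (μ := μ) (ν := ν) fun s t ht => by
    rw [hiid s t ht, hν']
    exact Finset.prod_congr rfl fun e _ => (Measure.restrict_apply (ht e)).symm
  have hleft : μ {U | mstEdges G U = wmsfEdges G U} = 1 ↔
      ∀ᵐ p ∂ν, ∀ x y, G.Adj x y →
        ∀ᵐ U ∂μ, ¬ InfSep ({f | f ∈ G.edgeSet ∧ U f < p} \ {s(x, y)}) x y := by
    have hmeas : MeasurableSet {U | mstEdges G U = wmsfEdges G U} := by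
      simp only [mstEdges_eq_wmsfEdges_iff hlf, Set.ofPred_forall]
      refine .iInter fun x => .iInter fun y => .iInter fun _ => ?_
      refine (measurableSet_infSep (fun f => ?_) x y).compl
      exact (MeasurableSet.const _).inter
        (measurableSet_lt (measurable_pi_apply f) (measurable_pi_apply _))
    rw [← prob_compl_eq_zero_iff hmeas, ← mem_ae_iff]
    change (∀ᵐ U ∂μ, mstEdges G U = wmsfEdges G U) ↔ _
    simp only [mstEdges_eq_wmsfEdges_iff hlf, ae_all_iff]
    exact forall₃_congr fun x y _ => ae_not_infSep_lt_label_iff G (hupd s(x, y))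
  rw [hleft]
  refine eventually_congr ((ae_restrict_mem measurableSet_Ioo).mono fun p hp => ?_)
  have hp₁ : ν (Set.Iio p) ≠ 0 := by
    rw [hν, Measure.restrict_apply measurableSet_Iio, Set.Iio_inter_Ioo, min_eq_left hp.2.le,
      Real.volume_Ioo]
    simpa using hp.1
  have hp₂ : ν (Set.Ioi p) ≠ 0 := by
    rw [hν, Measure.restrict_apply measurableSet_Ioi, Set.Ioi_inter_Ioo, max_eq_left hp.1.le,
      Real.volume_Ioo]
    simpa using hp.2
  rw [ae_forall_not_infSep_diff_iff G hG hupd hp₁ hp₂]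
  have hmeas : MeasurableSet {U : Sym2 V → ℝ |
      ∀ x y, ¬ InfSep {f | f ∈ G.edgeSet ∧ U f < p} x y} := by
    simp only [Set.ofPred_forall]
    refine .iInter fun x => .iInter fun y => (measurableSet_infSep (fun f => ?_) x y).compl
    simpa using measurableSet_mem_percolation G p ∅ f
  change {U | ∀ x y, ¬ InfSep {f | f ∈ G.edgeSet ∧ U f < p} x y} ∈ ae μ ↔ _
  rw [mem_ae_iff, prob_compl_eq_zero_iff hmeas]
  simp only [InfSep, not_and, not_not]
end
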